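/- For all δ>0 there exists Δ₀=Δ₀(δ) such that for every finite graph G=(V,E) with maximum degree Δ≥Δ₀ and every 0<λ<(1−δ)·λ_c(Δ): for any initial value ω⁰∈[0,1]^V and every integer i≥0, the i-th iterate ω^i = F^i(ω⁰) of the belief-propagation operator satisfies ‖ω^i − ω*‖_∞ ≤ 3·(1−δ/6)^i, where ω* is the unique fixed point of F. -/

import Mathlib

open scoped BigOperators

noncomputable section

namespace HardCore

/-- The critical fugacity `λ_c(Δ) = (Δ-1)^(Δ-1) / (Δ-2)^Δ`. -/
def lambdaC (D : ℕ) : ℝ := ((D : ℝ) - 1) ^ (D - 1) / ((D : ℝ) - 2) ^ D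

variable {V : Type} [Fintype V] [DecidableEq V]

/-- The belief-propagation operator `F(ω)(v) = ∏_{u ∈ N(v)} 1/(1 + λ·ω(u))`. -/
def bpF (G : SimpleGraph V) [DecidableRel G.Adj] (lam : ℝ) (ω : V → ℝ) : V → ℝ :=
  fun v => ∏ u ∈ G.neighborFinset v, (1 + lam * ω u)⁻¹

end HardCore

open HardCore

namespace HardCore

/-- The square root of `∏ (1 + λ c_u²)⁻¹`, written as an exponential. -/
lemma sqrt_prod_inv_eq_exp {ι : Type*} (s : Finset ι) {lam : ℝ} (hlam : 0 < lam) (c : ι → ℝ) :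
    √(∏ u ∈ s, (1 + lam * c u ^ 2)⁻¹) =
      Real.exp (-(1 / 2) * ∑ u ∈ s, Real.log (1 + lam * c u ^ 2)) := by
  have hpos : ∀ u, 0 < 1 + lam * c u ^ 2 := fun u => by positivity
  rw [Real.sqrt_eq_iff_mul_self_eq (Finset.prod_nonneg fun u _ => (inv_pos.2 (hpos u)).le)
    (Real.exp_pos _).le, ← Real.exp_add]
  rw [show -(1 / 2) * ∑ u ∈ s, Real.log (1 + lam * c u ^ 2) +
      -(1 / 2) * ∑ u ∈ s, Real.log (1 + lam * c u ^ 2) =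
      ∑ u ∈ s, -Real.log (1 + lam * c u ^ 2) by rw [Finset.sum_neg_distrib]; ring, Real.exp_sum]
  refine Finset.prod_congr rfl fun u _ => ?_
  rw [Real.exp_neg, Real.exp_log (hpos u)]

/-- The gradient of `c ↦ ∏ (1 + λ c_u²)^(-1/2)` on `[0,1]^s` has small `ℓ¹`-norm. -/
lemma exp_mul_sum_le {ι : Type*} (s : Finset ι) {lam α : ℝ} (hlam : 0 < lam) (hα : 0 ≤ α)
    (h : lam * (1 + lam) * s.card ≤ α ^ 2 * Real.exp 1) (c : ι → ℝ)
    (hc : ∀ u, c u ∈ Set.Icc (0 : ℝ) 1) :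
    Real.exp (-(1 / 2) * ∑ u ∈ s, Real.log (1 + lam * c u ^ 2)) * (lam * ∑ u ∈ s, c u) ≤ α := by
  set S := ∑ u ∈ s, c u ^ 2 with hS
  have hS0 : 0 ≤ S := Finset.sum_nonneg fun u _ => sq_nonneg _
  have hlog : lam / (1 + lam) * S ≤ ∑ u ∈ s, Real.log (1 + lam * c u ^ 2) := by
    rw [hS, Finset.mul_sum]
    refine Finset.sum_le_sum fun u _ => ?_
    have hpos : 0 < 1 + lam * c u ^ 2 := by positivity
    have hc1 : c u ^ 2 ≤ 1 := pow_le_one₀ (hc u).1 (hc u).2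
    refine le_trans ?_ (Real.one_sub_inv_le_log_of_pos hpos)
    have : 1 - (1 + lam * c u ^ 2)⁻¹ = lam / (1 + lam * c u ^ 2) * c u ^ 2 := by
      field_simp; ring
    rw [this]
    gcongr
    nlinarith
  have hcs : (∑ u ∈ s, c u) ^ 2 ≤ s.card * S := sq_sum_le_card_mul_sum_sq
  have hmax : lam / (1 + lam) * S * Real.exp (-(lam / (1 + lam) * S)) ≤ Real.exp (-1) := by
    have := Real.add_one_le_exp (lam / (1 + lam) * S - 1)
    calc _ ≤ Real.exp (lam / (1 + lam) * S - 1) * Real.exp (-(lam / (1 + lam) * S)) := by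
          gcongr; linarith
      _ = _ := by rw [← Real.exp_add]; congr 1; ring
  have hexp : Real.exp (-(1 / 2) * ∑ u ∈ s, Real.log (1 + lam * c u ^ 2)) ^ 2 ≤
      Real.exp (-(lam / (1 + lam) * S)) := by
    rw [← Real.exp_nat_mul]
    refine Real.exp_le_exp.2 ?_
    push_cast
    linarith
  refine abs_le_of_sq_le_sq' ?_ hα |>.2
  calc _ = Real.exp (-(1 / 2) * ∑ u ∈ s, Real.log (1 + lam * c u ^ 2)) ^ 2 *
        (lam ^ 2 * (∑ u ∈ s, c u) ^ 2) := by ring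
    _ ≤ Real.exp (-(lam / (1 + lam) * S)) * (lam ^ 2 * (s.card * S)) := by gcongr
    _ = lam * (1 + lam) * s.card *
        (lam / (1 + lam) * S * Real.exp (-(lam / (1 + lam) * S))) := by field_simp
    _ ≤ α ^ 2 * Real.exp 1 * Real.exp (-1) := by gcongr
    _ = α ^ 2 := by rw [mul_assoc, ← Real.exp_add]; simp

/-- In square-root coordinates one coordinate of the belief-propagation operator is
`α`-Lipschitz for the supremum norm. -/
lemma abs_sqrt_prod_sub_le {ι : Type*} (s : Finset ι) {lam α M : ℝ} (hlam : 0 < lam) (hα : 0 ≤ α)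
    (h : lam * (1 + lam) * s.card ≤ α ^ 2 * Real.exp 1) (a b : ι → ℝ)
    (ha : ∀ u, a u ∈ Set.Icc (0 : ℝ) 1) (hb : ∀ u, b u ∈ Set.Icc (0 : ℝ) 1)
    (hM : 0 ≤ M) (hab : ∀ u, |a u - b u| ≤ M) :
    |√(∏ u ∈ s, (1 + lam * a u ^ 2)⁻¹) - √(∏ u ∈ s, (1 + lam * b u ^ 2)⁻¹)| ≤ α * M := by
  let c : ℝ → ι → ℝ := fun t u => b u + t * (a u - b u)
  let g : ℝ → ℝ := fun t => Real.exp (-(1 / 2) * ∑ u ∈ s, Real.log (1 + lam * c t u ^ 2))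
  have hpos : ∀ t u, 0 < 1 + lam * c t u ^ 2 := fun t u => by positivity
  have hderiv : ∀ t, HasDerivAt g (g t * (-(1 / 2) * ∑ u ∈ s,
      lam * (2 * c t u * (a u - b u)) / (1 + lam * c t u ^ 2))) t := by
    intro t
    refine HasDerivAt.exp (HasDerivAt.const_mul _ (HasDerivAt.fun_sum fun u _ => ?_))
    refine HasDerivAt.log ?_ (hpos t u).ne'
    have h1 : HasDerivAt (fun t => c t u) (a u - b u) t := by
      simpa [c] using (hasDerivAt_mul_const (x := t) (a u - b u)).const_add (b u)
    simpa using ((h1.pow 2).const_mul lam).const_add 1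
  have hmem : ∀ t ∈ Set.Icc (0 : ℝ) 1, ∀ u, c t u ∈ Set.Icc (0 : ℝ) 1 := by
    intro t ht u
    have := (convex_Icc (0 : ℝ) 1).add_smul_sub_mem (hb u) (ha u) ht
    simpa [c] using this
  have hbound : ∀ t ∈ Set.Icc (0 : ℝ) 1, ‖g t * (-(1 / 2) * ∑ u ∈ s,
      lam * (2 * c t u * (a u - b u)) / (1 + lam * c t u ^ 2))‖ ≤ α * M := by
    intro t ht
    have hsum : |∑ u ∈ s, lam * (2 * c t u * (a u - b u)) / (1 + lam * c t u ^ 2)| ≤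
        2 * (lam * ∑ u ∈ s, c t u) * M := by
      refine (Finset.abs_sum_le_sum_abs _ _).trans ?_
      rw [Finset.mul_sum, Finset.mul_sum, Finset.sum_mul]
      refine Finset.sum_le_sum fun u _ => ?_
      have h0 := (hmem t ht u).1
      rw [abs_div, abs_mul, abs_mul, abs_of_pos hlam, abs_of_pos (hpos t u),
        abs_of_nonneg (by positivity : 0 ≤ 2 * c t u)]
      calc _ ≤ lam * (2 * c t u * |a u - b u|) :=
            div_le_self (by positivity) (by nlinarith [mul_nonneg hlam.le (sq_nonneg (c t u))])
        _ ≤ lam * (2 * c t u * M) := by gcongr; exact hab u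
        _ = _ := by ring
    rw [Real.norm_eq_abs, abs_mul, abs_mul, abs_of_pos (Real.exp_pos _ : 0 < g t)]
    calc _ ≤ g t * (|-(1 / 2 : ℝ)| * (2 * (lam * ∑ u ∈ s, c t u) * M)) := by
          gcongr
      _ = g t * (lam * ∑ u ∈ s, c t u) * M := by norm_num; ring
      _ ≤ α * M := by
          gcongr
          exact exp_mul_sum_le s hlam hα h (c t) (hmem t ht)
  have hmv := (convex_Icc (0 : ℝ) 1).norm_image_sub_le_of_norm_hasDerivWithin_le
    (fun t _ => (hderiv t).hasDerivWithinAt) hbound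
    (Set.left_mem_Icc.2 zero_le_one) (Set.right_mem_Icc.2 zero_le_one)
  rw [sqrt_prod_inv_eq_exp s hlam, sqrt_prod_inv_eq_exp s hlam]
  simpa [g, c] using hmv

lemma bpF_mem_Icc {V : Type} [Fintype V] [DecidableEq V] (G : SimpleGraph V) [DecidableRel G.Adj]
    {lam : ℝ} (hlam : 0 < lam) {ω : V → ℝ} (hω : ∀ u, ω u ∈ Set.Icc (0 : ℝ) 1) (v : V) :
    bpF G lam ω v ∈ Set.Icc (0 : ℝ) 1 := by
  have hge : ∀ u, 1 ≤ 1 + lam * ω u := fun u => by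
    linarith [mul_nonneg hlam.le (hω u).1]
  have hnn : ∀ u, 0 ≤ (1 + lam * ω u)⁻¹ := fun u => inv_nonneg.2 (zero_le_one.trans (hge u))
  exact ⟨Finset.prod_nonneg fun u _ => hnn u,
    Finset.prod_le_one (fun u _ => hnn u) fun u _ => inv_le_one_of_one_le₀ (hge u)⟩

lemma sqrt_mem_Icc {x : ℝ} (hx : x ∈ Set.Icc (0 : ℝ) 1) : √x ∈ Set.Icc (0 : ℝ) 1 :=
  ⟨Real.sqrt_nonneg x, Real.sqrt_le_one.2 hx.2⟩

lemma abs_sqrt_bpF_sub_le {V : Type} [Fintype V] [DecidableEq V] (G : SimpleGraph V)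
    [DecidableRel G.Adj] {lam α M : ℝ} (hlam : 0 < lam) (hα : 0 ≤ α)
    (h : lam * (1 + lam) * G.maxDegree ≤ α ^ 2 * Real.exp 1) {ω ω' : V → ℝ}
    (hω : ∀ u, ω u ∈ Set.Icc (0 : ℝ) 1) (hω' : ∀ u, ω' u ∈ Set.Icc (0 : ℝ) 1)
    (hM : 0 ≤ M) (hdist : ∀ u, |√(ω u) - √(ω' u)| ≤ M) (v : V) :
    |√(bpF G lam ω v) - √(bpF G lam ω' v)| ≤ α * M := by
  have hcard : lam * (1 + lam) * (G.neighborFinset v).card ≤ α ^ 2 * Real.exp 1 := by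
    refine le_trans ?_ h
    gcongr
    exact G.degree_le_maxDegree v
  have := abs_sqrt_prod_sub_le (G.neighborFinset v) hlam hα hcard (fun u => √(ω u))
    (fun u => √(ω' u)) (fun u => sqrt_mem_Icc (hω u)) (fun u => sqrt_mem_Icc (hω' u)) hM hdist
  simpa only [bpF, Real.sq_sqrt (hω _).1, Real.sq_sqrt (hω' _).1] using this

/-- A quantitative form of `Δ λ_c(Δ) → e`. -/
lemma lambdaC_mul_le {n : ℕ} (hn : 0 < n) :
    lambdaC (n + 2) * (n + 2) ≤ Real.exp 1 * ((1 + 1 / n) * (1 + 2 / n)) := by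
  have hn' : (0 : ℝ) < n := by exact_mod_cast hn
  have hexp : (1 + 1 / (n : ℝ)) ^ n ≤ Real.exp 1 := by
    calc _ ≤ Real.exp (1 / n) ^ n := by
          gcongr
          linarith [Real.add_one_le_exp (1 / (n : ℝ))]
      _ = Real.exp 1 := by rw [← Real.exp_nat_mul]; congr 1; field_simp
  have heq : lambdaC (n + 2) * (n + 2) =
      (1 + 1 / (n : ℝ)) ^ n * ((1 + 1 / n) * (1 + 2 / n)) := by
    have h1 : (1 + 1 / (n : ℝ)) = (n + 1) / n := by field_simp
    have h2 : ((n + 2 : ℕ) : ℝ) - 1 = n + 1 := by push_cast; ring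
    have h3 : ((n + 2 : ℕ) : ℝ) - 2 = n := by push_cast; ring
    rw [lambdaC, h2, h3, h1, div_pow, show n + 2 - 1 = n + 1 from rfl]
    field_simp
    ring
  rw [heq]
  gcongr

lemma lambdaC_pos {n : ℕ} (hn : 0 < n) : 0 < lambdaC (n + 2) := by
  have hn' : (0 : ℝ) < n := by exact_mod_cast hn
  unfold lambdaC
  push_cast
  apply div_pos <;> apply pow_pos <;> linarith

lemma lam_mul_le {δ lam : ℝ} {n : ℕ} (hδ : 0 < δ) (hδ1 : δ < 1) (hn : 400 / δ ≤ n)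
    (hlam : 0 < lam) (hlt : lam < (1 - δ) * lambdaC (n + 2)) :
    lam * (1 + lam) * (n + 2) ≤ (1 - δ / 6) ^ 2 * Real.exp 1 := by
  have hn' : (0 : ℝ) < n := lt_of_lt_of_le (by positivity) hn
  have hn0 : 0 < n := by exact_mod_cast hn'
  have hC := lambdaC_mul_le hn0
  have he : Real.exp 1 < 3 := Real.exp_one_lt_three
  have he0 := Real.exp_pos 1
  set x : ℝ := 1 / n with hx
  have hx0 : 0 < x := by positivity
  have hxδ : x ≤ δ / 400 := by
    rw [hx, div_le_div_iff₀ hn' (by norm_num)]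
    rw [div_le_iff₀ hδ] at hn
    linarith
  have h2 : (2 : ℝ) / n = 2 * x := by rw [hx]; ring
  rw [h2] at hC
  have hx1 : x ≤ 1 := by linarith
  have hp : (1 + x) * (1 + 2 * x) ≤ 1 + 5 * x := by nlinarith
  have hdeg : lam * (n + 2) ≤ (1 - δ) * (Real.exp 1 * (1 + 5 * x)) := by
    calc lam * (n + 2) ≤ (1 - δ) * lambdaC (n + 2) * (n + 2) := by gcongr
      _ = (1 - δ) * (lambdaC (n + 2) * (n + 2)) := by ring
      _ ≤ (1 - δ) * (Real.exp 1 * (1 + 5 * x)) := by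
          have : 0 ≤ 1 - δ := by linarith
          exact mul_le_mul_of_nonneg_left (hC.trans (by gcongr)) this
  have hlam18 : lam ≤ 18 * x := by
    have h18 : lam * (n + 2) ≤ 18 := by
      refine hdeg.trans ?_
      calc _ ≤ 1 * (Real.exp 1 * (1 + 5 * x)) := by gcongr; linarith
        _ ≤ 1 * (3 * (1 + 5 * 1)) := by gcongr
        _ = 18 := by norm_num
    rw [hx, mul_one_div, le_div_iff₀ hn']
    nlinarith
  calc lam * (1 + lam) * (n + 2) = lam * (n + 2) * (1 + lam) := by ring
    _ ≤ (1 - δ) * (Real.exp 1 * (1 + 5 * x)) * (1 + 18 * x) := by gcongr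
    _ = (1 - δ) * ((1 + 5 * x) * (1 + 18 * x)) * Real.exp 1 := by ring
    _ ≤ (1 - δ) * (1 + δ / 2) * Real.exp 1 := by
        have : 0 ≤ 1 - δ := by linarith
        gcongr
        nlinarith
    _ ≤ (1 - δ / 6) ^ 2 * Real.exp 1 := by gcongr; nlinarith

end HardCore

theorem bpF_iterates_converge :
    ∀ δ : ℝ, 0 < δ →
    ∃ Δ₀ : ℕ,
      ∀ (V : Type) [Fintype V] [DecidableEq V] (G : SimpleGraph V) [DecidableRel G.Adj]
        (Δ : ℕ) (lam : ℝ),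
        G.maxDegree = Δ → Δ₀ ≤ Δ →
        0 < lam → lam < (1 - δ) * lambdaC Δ →
        ∀ ωstar : V → ℝ, (∀ u : V, ωstar u ∈ Set.Icc (0 : ℝ) 1) →
          bpF G lam ωstar = ωstar →
        ∀ ω0 : V → ℝ, (∀ u : V, ω0 u ∈ Set.Icc (0 : ℝ) 1) →
        ∀ i : ℕ, ‖(bpF G lam)^[i] ω0 - ωstar‖ ≤ 3 * (1 - δ / 6) ^ i := by
  intro δ hδ
  refine ⟨⌈400 / δ⌉₊ + 2, ?_⟩
  intro V _ _ G _ Δ lam hΔ hΔ₀ hlam hlt ωstar hstar hfix ω0 hω0 i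
  obtain ⟨n, rfl⟩ : ∃ n, Δ = n + 2 := ⟨Δ - 2, by omega⟩
  have hn : 400 / δ ≤ n := Nat.ceil_le.1 (by omega)
  have hn0 : 0 < n := by
    have : (0 : ℝ) < n := lt_of_lt_of_le (by positivity) hn
    exact_mod_cast this
  have hδ1 : δ < 1 := by
    by_contra! hge
    nlinarith [lambdaC_pos hn0]
  have hα : 0 ≤ 1 - δ / 6 := by linarith
  have hcontr : lam * (1 + lam) * G.maxDegree ≤ (1 - δ / 6) ^ 2 * Real.exp 1 := by
    rw [hΔ]
    push_cast
    exact lam_mul_le hδ hδ1 hn hlam hlt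
  have hiter : ∀ i : ℕ, (∀ u, (bpF G lam)^[i] ω0 u ∈ Set.Icc (0 : ℝ) 1) ∧
      ∀ u, |√((bpF G lam)^[i] ω0 u) - √(ωstar u)| ≤ (1 - δ / 6) ^ i := by
    intro i
    induction i with
    | zero =>
      refine ⟨hω0, fun u => ?_⟩
      have h1 := sqrt_mem_Icc (hω0 u)
      have h2 := sqrt_mem_Icc (hstar u)
      rw [pow_zero, Function.iterate_zero, id, abs_le]
      constructor <;> linarith [h1.1, h1.2, h2.1, h2.2]
    | succ i ih =>
      simp only [Function.iterate_succ_apply']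
      refine ⟨bpF_mem_Icc G hlam ih.1, fun u => ?_⟩
      have := abs_sqrt_bpF_sub_le G hlam hα hcontr ih.1 hstar (by positivity) ih.2 u
      rwa [hfix, ← pow_succ'] at this
  obtain ⟨hmem, hdist⟩ := hiter i
  refine (pi_norm_le_iff_of_nonneg (by positivity)).2 fun u => ?_
  have h1 := sqrt_mem_Icc (hmem u)
  have h2 := sqrt_mem_Icc (hstar u)
  have hfactor : (bpF G lam)^[i] ω0 u - ωstar u =
      (√((bpF G lam)^[i] ω0 u) + √(ωstar u)) * (√((bpF G lam)^[i] ω0 u) - √(ωstar u)) := by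
    rw [← sq_sub_sq, Real.sq_sqrt (hmem u).1, Real.sq_sqrt (hstar u).1]
  rw [Pi.sub_apply, Real.norm_eq_abs, hfactor, abs_mul, abs_of_nonneg (add_nonneg h1.1 h2.1)]
  exact mul_le_mul (by linarith [h1.2, h2.2]) (hdist u) (abs_nonneg _) (by norm_num)
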